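/- arXiv:2403.03524 — 10 statements merged into one kernel-verified Lean document; each statement's English description precedes it below -/
import Mathlib

section
/- For every s > 0 and y > 0, with δ = min{2, β}: E[ e^{s·min{X_1, y}} ] ≤ 1 + sμ + s^δ·MG_δ·μ_δ^- + e^β·s^δ·ME_δ·μ_δ^+ + ((e^{sy} − 1 − sy)/y^β)·μ_β^+. -/
open MeasureTheory Real

/-- `ME δ = sup_{v>0} (1 - (1+v) e^{-v}) / v^δ`. -/
noncomputable def ME (δ : ℝ) : ℝ :=
  ⨆ v : Set.Ioi (0:ℝ), (1 - (1 + (v : ℝ)) * Real.exp (-(v : ℝ))) / (v : ℝ) ^ δ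

/-- `MG δ = sup_{u>0} (e^{-u} - 1 + u) / u^δ`. -/
noncomputable def MG (δ : ℝ) : ℝ :=
  ⨆ u : Set.Ioi (0:ℝ), (Real.exp (-(u : ℝ)) - 1 + (u : ℝ)) / (u : ℝ) ^ δ


lemma aux_pow {v δ : ℝ} (h0 : 0 < v) (h1 : v ≤ 1) (h2 : δ ≤ 2) : v ^ 2 ≤ v ^ δ := by
  have := Real.rpow_le_rpow_of_exponent_ge h0 h1 h2
  simpa using this

lemma aux_ME {δ : ℝ} (h1 : 1 < δ) (h2 : δ ≤ 2) {v : ℝ} (hv : 0 < v) :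
    1 - (1 + v) * Real.exp (-v) ≤ ME δ * v ^ δ := by
  have hp : 0 < v ^ δ := Real.rpow_pos_of_pos hv _
  rw [← div_le_iff₀ hp]
  refine le_ciSup (f := fun v : Set.Ioi (0:ℝ) =>
    (1 - (1 + (v : ℝ)) * Real.exp (-(v : ℝ))) / (v : ℝ) ^ δ) ⟨1, ?_⟩ ⟨v, hv⟩
  rintro _ ⟨⟨u, hu⟩, rfl⟩
  have hu : 0 < u := hu
  have hpu : 0 < u ^ δ := Real.rpow_pos_of_pos hu _
  show (1 - (1 + u) * Real.exp (-u)) / u ^ δ ≤ 1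
  rw [div_le_one hpu]
  rcases le_total u 1 with h | h
  · have := aux_pow hu h h2
    have := Real.add_one_le_exp (-u)
    nlinarith
  · have := Real.one_le_rpow h (by linarith : 0 ≤ δ)
    have : 0 < (1 + u) * Real.exp (-u) := by positivity
    linarith

lemma aux_MG {δ : ℝ} (h1 : 1 < δ) (h2 : δ ≤ 2) {v : ℝ} (hv : 0 < v) :
    Real.exp (-v) - 1 + v ≤ MG δ * v ^ δ := by
  have hp : 0 < v ^ δ := Real.rpow_pos_of_pos hv _
  rw [← div_le_iff₀ hp]
  refine le_ciSup (f := fun u : Set.Ioi (0:ℝ) =>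
    (Real.exp (-(u : ℝ)) - 1 + (u : ℝ)) / (u : ℝ) ^ δ) ⟨1, ?_⟩ ⟨v, hv⟩
  rintro _ ⟨⟨u, hu⟩, rfl⟩
  have hu : 0 < u := hu
  have hpu : 0 < u ^ δ := Real.rpow_pos_of_pos hu _
  show (Real.exp (-u) - 1 + u) / u ^ δ ≤ 1
  rw [div_le_one hpu]
  rcases le_total u 1 with h | h
  · have := aux_pow hu h h2
    have h3 := Real.abs_exp_sub_one_sub_id_le (x := -u) (by rw [abs_neg, abs_of_pos hu]; exact h)
    have := le_abs_self (Real.exp (-u) - 1 - -u)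
    nlinarith
  · have h3 : u ^ (1:ℝ) ≤ u ^ δ := Real.rpow_le_rpow_of_exponent_le h h1.le
    rw [Real.rpow_one] at h3
    have : Real.exp (-u) ≤ 1 := Real.exp_le_one_iff.2 (by linarith)
    linarith

lemma aux_f_nonneg (t : ℝ) : 0 ≤ Real.exp t - 1 - t := by
  have := Real.add_one_le_exp t
  linarith

lemma aux_mono {β t T : ℝ} (hβ : 1 < β) (h1 : β ≤ t) (h2 : t ≤ T) :
    (Real.exp t - 1 - t) * (T / t) ^ β ≤ Real.exp T - 1 - T := by
  have ht : 0 < t := by linarith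
  have hT : 0 < T := by linarith
  have e1 : (T / t) ^ β ≤ Real.exp (T - t) := by
    have h3 : T / t ≤ Real.exp (T / t - 1) := by
      have := Real.add_one_le_exp (T / t - 1)
      linarith
    calc (T / t) ^ β ≤ (Real.exp (T / t - 1)) ^ β :=
          Real.rpow_le_rpow (by positivity) h3 (by linarith)
      _ = Real.exp ((T / t - 1) * β) := by rw [← Real.exp_mul]
      _ ≤ Real.exp (T - t) := by
          apply Real.exp_le_exp.2
          have h4 : 0 ≤ T / t - 1 := by
            rw [sub_nonneg, le_div_iff₀ ht]; linarith
          have h5 : (T / t - 1) * t = T - t := by field_simp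
          nlinarith
  have e2 : Real.exp T = Real.exp t * Real.exp (T - t) := by
    rw [← Real.exp_add]; congr 1; ring
  have e3 := Real.add_one_le_exp (T - t)
  have e4 := mul_le_mul_of_nonneg_left e1 (aux_f_nonneg t)
  have e5 : (1 + t) * (T - t + 1) ≤ (1 + t) * Real.exp (T - t) :=
    mul_le_mul_of_nonneg_left e3 (by linarith)
  nlinarith [mul_nonneg ht.le (sub_nonneg.2 h2)]

lemma aux_pt {β : ℝ} (hβ : 1 < β) {s y : ℝ} (hs : 0 < s) (hy : 0 < y) (x : ℝ) :
    Real.exp (s * min x y) ≤ 1 + s * x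
      + s ^ min 2 β * MG (min 2 β) * max (-x) 0 ^ min 2 β
      + Real.exp β * s ^ min 2 β * ME (min 2 β) * max x 0 ^ min 2 β
      + (Real.exp (s * y) - 1 - s * y) / y ^ β * max x 0 ^ β := by
  have hδ1 : 1 < min 2 β := lt_min (by norm_num) hβ
  have hδ2 : min 2 β ≤ 2 := min_le_left _ _
  generalize min 2 β = δ at *
  have hβ0 : β ≠ 0 := by linarith
  have hδ0 : δ ≠ 0 := by linarith
  rcases lt_trichotomy x 0 with hx | hx | hx
  · rw [max_eq_right hx.le, max_eq_left (by linarith : 0 ≤ -x), min_eq_left (by linarith),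
      Real.zero_rpow hβ0, Real.zero_rpow hδ0]
    have h := aux_MG hδ1 hδ2 (v := s * (-x)) (by nlinarith)
    rw [Real.mul_rpow hs.le (by linarith)] at h
    have e : -(s * -x) = s * x := by ring
    rw [e] at h
    linarith
  · subst hx
    simp [Real.zero_rpow hβ0, Real.zero_rpow hδ0, min_eq_left hy.le]
  · rw [max_eq_left hx.le, max_eq_right (by linarith : -x ≤ 0), Real.zero_rpow hδ0]
    have ht : 0 < s * x := by positivity
    have hM := aux_ME hδ1 hδ2 ht
    rw [Real.mul_rpow hs.le hx.le] at hM
    have hxy : (Real.exp (s * y) - 1 - s * y) / y ^ β * x ^ β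
        = (Real.exp (s * y) - 1 - s * y) * (x / y) ^ β := by
      rw [Real.div_rpow hx.le hy.le]; ring
    rw [hxy]
    have hE : Real.exp (s * x) * Real.exp (-(s * x)) = 1 := by
      rw [← Real.exp_add]; simp
    have hMn : 0 ≤ ME δ * (s ^ δ * x ^ δ) := by
      refine le_trans ?_ hM
      have := aux_f_nonneg (s * x)
      have h3 := Real.exp_pos (-(s * x))
      nlinarith
    have hFn := aux_f_nonneg (s * y)
    have hBn : 0 ≤ Real.exp β * (ME δ * (s ^ δ * x ^ δ)) := mul_nonneg (Real.exp_pos _).le hMn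
    rcases le_total y x with h | h
    · rw [min_eq_right h]
      have h3 : 1 ≤ (x / y) ^ β := by
        apply Real.one_le_rpow _ (by linarith)
        rw [le_div_iff₀ hy]; linarith
      have h4 := mul_le_mul_of_nonneg_left h3 hFn
      have h5 : s * y ≤ s * x := by gcongr
      linarith
    · rw [min_eq_left h]
      have hPn : 0 ≤ (Real.exp (s * y) - 1 - s * y) * (x / y) ^ β :=
        mul_nonneg hFn (by positivity)
      rcases le_total (s * x) β with hc | hc
      · have h3 := mul_le_mul_of_nonneg_left hM (Real.exp_pos (s * x)).le
        have h4 := mul_le_mul_of_nonneg_right (Real.exp_le_exp.2 hc) hMn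
        have h5 : Real.exp (s * x) * (1 - (1 + s * x) * Real.exp (-(s * x)))
            = Real.exp (s * x) - 1 - s * x := by linear_combination (-(1 + s * x)) * hE
        linarith
      · have h3 := aux_mono hβ hc (T := s * y) (by gcongr)
        have h4 := mul_le_mul_of_nonneg_right h3 (by positivity : 0 ≤ (x / y) ^ β)
        have h5 : (s * y / (s * x)) ^ β * (x / y) ^ β = 1 := by
          rw [← Real.mul_rpow (by positivity) (by positivity)]
          have : s * y / (s * x) * (x / y) = 1 := by field_simp
          rw [this, Real.one_rpow]
        rw [mul_assoc, h5] at h4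
        linarith

/-- Bound (2.19) on the moment generating function of a truncated variable:
for `s > 0`, `y > 0` and `δ = min 2 β`,
`E[e^{s min(X,y)}] ≤ 1 + sμ + s^δ MG_δ μ_δ^- + e^β s^δ ME_δ μ_δ^+ +
((e^{sy}-1-sy)/y^β) μ_β^+`. -/
theorem truncated_mgf_bound
    {Ω : Type*} [MeasurableSpace Ω] (P : Measure Ω) [IsProbabilityMeasure P]
    (X : Ω → ℝ) (hX : Measurable X)
    (β : ℝ) (hβ : 1 < β)
    (hint : Integrable X P)
    (hmom : Integrable (fun ω => |X ω| ^ β) P)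
    (hmomδp : Integrable (fun ω => max (X ω) 0 ^ min 2 β) P)
    (hmomδm : Integrable (fun ω => max (-X ω) 0 ^ min 2 β) P)
    (s y : ℝ) (hs : 0 < s) (hy : 0 < y) :
    ∫ ω, Real.exp (s * min (X ω) y) ∂P
      ≤ 1 + s * (∫ ω, X ω ∂P)
        + s ^ min 2 β * MG (min 2 β) * ∫ ω, max (-X ω) 0 ^ min 2 β ∂P
        + Real.exp β * s ^ min 2 β * ME (min 2 β) * ∫ ω, max (X ω) 0 ^ min 2 β ∂P
        + (Real.exp (s * y) - 1 - s * y) / y ^ β * ∫ ω, max (X ω) 0 ^ β ∂P := by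
  have hβp : Integrable (fun ω => max (X ω) 0 ^ β) P := by
    refine hmom.mono' ((hX.max measurable_const).pow_const β).aestronglyMeasurable ?_
    refine Filter.Eventually.of_forall fun ω => ?_
    have h0 : 0 ≤ max (X ω) 0 := le_max_right _ _
    rw [Real.norm_of_nonneg (Real.rpow_nonneg h0 _)]
    exact Real.rpow_le_rpow h0 (max_le (le_abs_self _) (abs_nonneg _)) (by linarith)
  have i1 : Integrable (fun ω => 1 + s * X ω) P := (integrable_const _).add (hint.const_mul s)
  have i2 := hmomδm.const_mul (s ^ min 2 β * MG (min 2 β))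
  have i3 := hmomδp.const_mul (Real.exp β * s ^ min 2 β * ME (min 2 β))
  have i4 := hβp.const_mul ((Real.exp (s * y) - 1 - s * y) / y ^ β)
  have key := integral_mono_of_nonneg (μ := P)
    (f := fun ω => Real.exp (s * min (X ω) y))
    (Filter.Eventually.of_forall fun ω => (Real.exp_pos _).le)
    (((i1.add i2).add i3).add i4)
    (Filter.Eventually.of_forall fun ω => aux_pt hβ hs hy (X ω))
  refine key.trans (le_of_eq ?_)
  rw [integral_add' ((i1.add i2).add i3) i4, integral_add' (i1.add i2) i3, integral_add' i1 i2,
    integral_add (integrable_const _) (hint.const_mul s)]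
  simp only [integral_const_mul]
  simp
end

section
/- For every s ≥ 0 and y > 0, writing Z = min{X, y} and δ = min{2, β}: E[ (e^{sZ} − 1 − sZ)·1{X > 0} ] ≤ e^β·s^δ·ME_δ·E[(max{X,0})^δ] + ((e^{sy} − 1 − sy)/y^β)·E[(max{X,0})^β]. -/
open MeasureTheory Real

lemma ME_aux (δ v : ℝ) (h1 : 1 < δ) (h2 : δ ≤ 2) (hv : 0 < v) :
    (1 - (1 + v) * Real.exp (-v)) / v ^ δ ≤ ME δ := by
  have hb : BddAbove (Set.range (fun v : Set.Ioi (0:ℝ) =>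
      (1 - (1 + (v : ℝ)) * Real.exp (-(v : ℝ))) / (v : ℝ) ^ δ)) := by
    refine ⟨1, ?_⟩
    rintro _ ⟨⟨w, hw⟩, rfl⟩
    have hw : 0 < w := hw
    show (1 - (1 + w) * Real.exp (-w)) / w ^ δ ≤ 1
    rw [div_le_one (Real.rpow_pos_of_pos hw δ)]
    have he := Real.add_one_le_exp (-w)
    have hp := Real.exp_pos (-w)
    rcases le_total w 1 with h | h
    · have : w ^ (2:ℝ) ≤ w ^ δ := Real.rpow_le_rpow_of_exponent_ge hw h h2
      rw [Real.rpow_two] at this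
      nlinarith
    · have : 1 ≤ w ^ δ := Real.one_le_rpow h (by linarith)
      nlinarith
  exact le_ciSup hb (⟨v, hv⟩ : Set.Ioi (0:ℝ))

lemma g_mono (β u w : ℝ) (hβ : 1 < β) (hu : β ≤ u) (hw : u ≤ w) :
    (w / u) ^ β * (Real.exp u - 1 - u) ≤ Real.exp w - 1 - w := by
  have hu0 : 0 < u := by linarith
  have hw0 : 0 < w := by linarith
  have h0 : 0 ≤ Real.exp u - 1 - u := by linarith [Real.add_one_le_exp u]
  have h1 : (w / u) ^ β ≤ Real.exp (w - u) := by
    rw [Real.rpow_def_of_pos (by positivity)]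
    apply Real.exp_le_exp.mpr
    have hl := Real.log_le_sub_one_of_pos (show 0 < w / u by positivity)
    have hn : 0 ≤ w / u - 1 := by
      rw [sub_nonneg, one_le_div hu0]; exact hw
    have e : (w / u - 1) * u = w - u := by field_simp
    nlinarith
  have h2 := Real.add_one_le_exp (w - u)
  have h3 : Real.exp (w - u) * Real.exp u = Real.exp w := by
    rw [← Real.exp_add]; ring_nf
  calc _ ≤ Real.exp (w - u) * (Real.exp u - 1 - u) := by gcongr
    _ ≤ _ := by nlinarith

lemma ptw (β s y x : ℝ) (hβ : 1 < β) (hs : 0 < s) (hy : 0 < y) (hx : 0 < x) :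
    Real.exp (s * min x y) - 1 - s * min x y
      ≤ Real.exp β * s ^ min 2 β * ME (min 2 β) * x ^ min 2 β
        + (Real.exp (s * y) - 1 - s * y) / y ^ β * x ^ β := by
  have hd1 : 1 < min 2 β := lt_min (by norm_num) hβ
  have hd2 : min 2 β ≤ 2 := min_le_left _ _
  generalize min 2 β = δ at *
  have hME := ME_aux δ (s * x) hd1 hd2 (by positivity)
  have hq : ∀ v : ℝ, 1 - (1 + v) * Real.exp (-v) = Real.exp (-v) * (Real.exp v - 1 - v) := by
    intro v
    have : Real.exp (-v) * Real.exp v = 1 := by rw [← Real.exp_add]; simp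
    linear_combination -this
  have hg : ∀ v : ℝ, 0 ≤ Real.exp v - 1 - v := fun v => by linarith [Real.add_one_le_exp v]
  have hME0 : 0 ≤ ME δ := by
    refine le_trans ?_ hME
    rw [hq]
    have := hg (s * x)
    positivity
  have hgy := hg (s * y)
  have hyb : 0 < y ^ β := Real.rpow_pos_of_pos hy β
  have hA : 0 ≤ Real.exp β * s ^ δ * ME δ * x ^ δ := by positivity
  have hB : 0 ≤ (Real.exp (s * y) - 1 - s * y) / y ^ β * x ^ β := by positivity
  rcases le_total y x with h | h
  · rw [min_eq_right h]
    have : y ^ β ≤ x ^ β := Real.rpow_le_rpow hy.le h (by linarith)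
    have : Real.exp (s * y) - 1 - s * y ≤ (Real.exp (s * y) - 1 - s * y) / y ^ β * x ^ β := by
      rw [div_mul_eq_mul_div, le_div_iff₀ hyb]
      gcongr
    linarith
  · rw [min_eq_left h]
    rcases le_total (s * x) β with hb | hb
    · rw [div_le_iff₀ (by positivity), hq, Real.mul_rpow hs.le hx.le] at hME
      have h1 : Real.exp (s * x) - 1 - s * x ≤ Real.exp (s * x) * (ME δ * (s ^ δ * x ^ δ)) := by
        have := mul_le_mul_of_nonneg_left hME (Real.exp_pos (s * x)).le
        rwa [← mul_assoc, ← Real.exp_add, add_neg_cancel, Real.exp_zero, one_mul] at this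
      have h2 : Real.exp (s * x) * (ME δ * (s ^ δ * x ^ δ))
          ≤ Real.exp β * (ME δ * (s ^ δ * x ^ δ)) := by gcongr
      linarith
    · have hm := g_mono β (s * x) (s * y) hβ hb (by gcongr)
      rw [mul_div_mul_left _ _ hs.ne', Real.div_rpow hy.le hx.le, div_mul_eq_mul_div,
        div_le_iff₀ (by positivity)] at hm
      have : Real.exp (s * x) - 1 - s * x ≤ (Real.exp (s * y) - 1 - s * y) / y ^ β * x ^ β := by
        rw [div_mul_eq_mul_div, le_div_iff₀ hyb]
        linarith
      linarith

/-- Bound (2.17): for `s ≥ 0`, `y > 0`, `Z = min(X,y)` and `δ = min 2 β`,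
`E[(e^{sZ} - 1 - sZ) 1{X > 0}]
  ≤ e^β s^δ ME_δ E[(max(X,0))^δ] + ((e^{sy}-1-sy)/y^β) E[(max(X,0))^β]`. -/
theorem positive_part_taylor_bound
    {Ω : Type*} [MeasurableSpace Ω] (P : Measure Ω) [IsProbabilityMeasure P]
    (X : Ω → ℝ) (hX : Measurable X)
    (β : ℝ) (hβ : 1 < β)
    (hmomβ : Integrable (fun ω => max (X ω) 0 ^ β) P)
    (hmomδ : Integrable (fun ω => max (X ω) 0 ^ min 2 β) P)
    (s y : ℝ) (hs : 0 ≤ s) (hy : 0 < y) :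
    ∫ ω, (if 0 < X ω then
        Real.exp (s * min (X ω) y) - 1 - s * min (X ω) y else 0) ∂P
      ≤ Real.exp β * s ^ min 2 β * ME (min 2 β) * (∫ ω, max (X ω) 0 ^ min 2 β ∂P)
        + (Real.exp (s * y) - 1 - s * y) / y ^ β * ∫ ω, max (X ω) 0 ^ β ∂P := by
  rcases hs.eq_or_lt with rfl | hs
  · have : min 2 β ≠ 0 := by
      have : 1 < min 2 β := lt_min (by norm_num) hβ
      linarith
    simp [Real.zero_rpow this]
  rw [← integral_const_mul, ← integral_const_mul,
    ← integral_add (hmomδ.const_mul _) (hmomβ.const_mul _)]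
  refine integral_mono_of_nonneg (Filter.Eventually.of_forall fun ω => ?_)
    ((hmomδ.const_mul _).add (hmomβ.const_mul _)) (Filter.Eventually.of_forall fun ω => ?_)
  · show (0:ℝ) ≤ if 0 < X ω then _ else _
    split_ifs
    · linarith [Real.add_one_le_exp (s * min (X ω) y)]
    · exact le_rfl
  · show (if 0 < X ω then _ else _) ≤ _
    split_ifs with h
    · have := ptw β s y (X ω) hβ hs hy h
      simpa [max_eq_left h.le] using this
    · have h1 : min 2 β ≠ 0 := by
        have : 1 < min 2 β := lt_min (by norm_num) hβ
        linarith
      have h2 : β ≠ 0 := by linarith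
      simp [max_eq_right (not_lt.mp h), Real.zero_rpow h1, Real.zero_rpow h2]
end

section
/- For every s > 0 and β > 1, the function x ↦ (e^{sx} − 1 − sx)/x^β is strictly increasing on the interval [β/s, ∞); equivalently, e^{sx}(sx − β) + (β−1)sx + β > 0 for all x ≥ β/s. -/
open Real

/-- (2.15): for `s > 0`, `β > 1`, the map `x ↦ (e^{sx} - 1 - sx)/x^β` is strictly
increasing on `[β/s, ∞)`; equivalently `e^{sx}(sx - β) + (β-1)sx + β > 0` there. -/
theorem taylor_ratio_strictMono (s β : ℝ) (hs : 0 < s) (hβ : 1 < β) :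
    StrictMonoOn (fun x : ℝ => (Real.exp (s * x) - 1 - s * x) / x ^ β)
      (Set.Ici (β / s)) ∧
    ∀ x : ℝ, β / s ≤ x →
      0 < Real.exp (s * x) * (s * x - β) + (β - 1) * (s * x) + β := by
  have key : ∀ x : ℝ, β / s ≤ x →
      0 < Real.exp (s * x) * (s * x - β) + (β - 1) * (s * x) + β := by
    intro x hx
    have h1 : β ≤ s * x := by
      rw [div_le_iff₀ hs] at hx
      linarith
    have h2 : 0 ≤ Real.exp (s * x) * (s * x - β) :=
      mul_nonneg (Real.exp_pos _).le (by linarith)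
    have h3 : 0 < (β - 1) * (s * x) := mul_pos (by linarith) (by linarith)
    linarith
  refine ⟨?_, key⟩
  have hb : 0 < β / s := div_pos (by linarith) hs
  have hd : ∀ x : ℝ, β / s ≤ x → HasDerivAt
      (fun x : ℝ => (Real.exp (s * x) - 1 - s * x) / x ^ β)
      (((Real.exp (s * x) * s - s) * x ^ β
        - (Real.exp (s * x) - 1 - s * x) * (β * x ^ (β - 1))) / (x ^ β) ^ 2) x := by
    intro x hx
    have hx0 : 0 < x := lt_of_lt_of_le hb hx
    have hl : HasDerivAt (fun x : ℝ => s * x) s x := by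
      simpa using (hasDerivAt_id x).const_mul s
    exact ((hl.exp.sub_const 1).sub hl).div
      (Real.hasDerivAt_rpow_const (Or.inl hx0.ne')) (Real.rpow_pos_of_pos hx0 β).ne'
  apply strictMonoOn_of_deriv_pos (convex_Ici _)
  · intro x hx
    exact (hd x hx).continuousAt.continuousWithinAt
  · intro x hx
    rw [interior_Ici] at hx
    have hx' : β / s ≤ x := le_of_lt hx
    have hx0 : 0 < x := lt_of_lt_of_le hb hx'
    rw [(hd x hx').deriv]
    apply div_pos _ (pow_pos (Real.rpow_pos_of_pos hx0 β) 2)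
    have e : x ^ β = x ^ (β - 1) * x := by
      rw [← Real.rpow_add_one hx0.ne', sub_add_cancel]
    rw [e]
    have := mul_pos (Real.rpow_pos_of_pos hx0 (β - 1)) (key x hx')
    linarith
end

section
/- For every η ∈ (0,1) there exists a finite threshold y*_η such that for all y > y*_η, setting s(y) = ( q(y) − log y + log(η|μ|) )/y, one has E[ exp( s(y)·min{X_1, y} ) ] ≤ 1; consequently the Cramér–Lundberg adjustment coefficient γ(y) = sup{ s ≥ 0 : E[e^{s min{X_1,y}}] ≤ 1 } satisfies γ(y) ≥ s(y). -/
open MeasureTheory Real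

lemma aux_pt_s10 (s a y t : ℝ) (hay : a ≤ y) :
    ∫ x in a..y, (if x < t then s * Real.exp (s * min x y) else 0)
      = Real.exp (s * min t y) - Real.exp (s * min t a) := by
  have h : ∫ x in a..y, (if x < t then s * Real.exp (s * min x y) else 0)
      = (fun x => Real.exp (s * min t x)) y - (fun x => Real.exp (s * min t x)) a := by
    apply intervalIntegral.integral_eq_sub_of_hasDeriv_right
    · fun_prop
    · intro x hx
      rw [min_eq_left hay, max_eq_right hay] at hx
      by_cases hxt : x < t
      · simp only [hxt, if_true]
        have h1 : HasDerivAt (fun x => Real.exp (s * x)) (s * Real.exp (s * min x y)) x := by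
          rw [min_eq_left hx.2.le]
          have := ((hasDerivAt_id x).const_mul s).exp
          simpa [mul_comm] using this
        refine (h1.congr_of_eventuallyEq ?_).hasDerivWithinAt
        filter_upwards [gt_mem_nhds hxt] with z hz
        rw [min_eq_right hz.le]
      · simp only [hxt, if_false]
        refine (hasDerivWithinAt_const x (Set.Ioi x) (Real.exp (s * t))).congr ?_ ?_
        · intro z hz
          have : x < z := hz
          rw [min_eq_left (by linarith)]
        · rw [min_eq_left (by linarith)]
    · rw [intervalIntegrable_iff_integrableOn_Ioc_of_le hay]
      have : IntegrableOn (fun x => s * Real.exp (s * min x y)) (Set.Ioc a y) :=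
        (Continuous.integrableOn_Icc (by fun_prop)).mono_set Set.Ioc_subset_Icc_self
      have h2 := Integrable.indicator this (measurableSet_Iio (a := t))
      refine h2.congr ?_
      filter_upwards with x
      simp [Set.indicator]
  exact h

lemma aux_layer {Ω : Type*} [MeasurableSpace Ω] (P : Measure Ω) [IsProbabilityMeasure P]
    (X : Ω → ℝ) (hX : Measurable X) (s a y M : ℝ) (hs : 0 < s) (hay : a ≤ y)
    (hM : ∀ x, a ≤ x → x ≤ y → Real.exp (s * x) * (P {ω | x < X ω}).toReal ≤ M) :
    ∫ ω, Real.exp (s * min (X ω) y) ∂P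
      ≤ ∫ ω, Real.exp (s * min (X ω) a) ∂P + s * M * (y - a) := by
  have hi : ∀ b : ℝ, Integrable (fun ω => Real.exp (s * min (X ω) b)) P := by
    intro b
    refine Integrable.of_bound (by fun_prop) (Real.exp (s * b)) ?_
    filter_upwards with ω
    rw [Real.norm_eq_abs, Real.abs_exp]
    exact Real.exp_le_exp.2 (mul_le_mul_of_nonneg_left (min_le_right _ _) hs.le)
  let f : Ω → ℝ → ℝ := fun ω x => if x < X ω then s * Real.exp (s * min x y) else 0
  have hfm : Measurable (Function.uncurry f) := by
    refine Measurable.ite (measurableSet_lt measurable_snd (hX.comp measurable_fst)) ?_ measurable_const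
    fun_prop
  have hfi : Integrable (Function.uncurry f) (P.prod (volume.restrict (Set.Ioc a y))) := by
    refine Integrable.of_bound hfm.aestronglyMeasurable (s * Real.exp (s * y)) ?_
    filter_upwards with p
    have h0 : s * Real.exp (s * min p.2 y) ≤ s * Real.exp (s * y) :=
      mul_le_mul_of_nonneg_left (Real.exp_le_exp.2
        (mul_le_mul_of_nonneg_left (min_le_right _ _) hs.le)) hs.le
    have h1 : 0 < s * Real.exp (s * min p.2 y) := by positivity
    have h2 : 0 < s * Real.exp (s * y) := by positivity
    simp only [Function.uncurry, f]
    split_ifs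
    · rw [Real.norm_eq_abs, abs_of_pos h1]; exact h0
    · simpa using h2.le
  have hsw := integral_integral_swap hfi
  have hl : ∫ ω, (∫ x in Set.Ioc a y, f ω x) ∂P =
      ∫ ω, Real.exp (s * min (X ω) y) ∂P - ∫ ω, Real.exp (s * min (X ω) a) ∂P := by
    rw [← integral_sub (hi y) (hi a)]
    refine integral_congr_ae (Filter.Eventually.of_forall fun ω => ?_)
    show ∫ x in Set.Ioc a y, f ω x = _
    rw [← intervalIntegral.integral_of_le hay]
    exact aux_pt_s10 s a y (X ω) hay
  have hr : ∫ x in Set.Ioc a y, (∫ ω, f ω x ∂P) ≤ ∫ x in Set.Ioc a y, s * M := by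
    refine setIntegral_mono_on hfi.integral_prod_right (integrable_const _) measurableSet_Ioc ?_
    intro x hx
    have e : ∫ ω, f ω x ∂P = s * Real.exp (s * x) * (P {ω | x < X ω}).toReal := by
      have : (fun ω => f ω x) = Set.indicator {ω | x < X ω} (fun _ => s * Real.exp (s * x)) := by
        ext ω
        simp [f, Set.indicator, min_eq_left hx.2]
      rw [this, integral_indicator_const _ (measurableSet_lt measurable_const hX)]
      simp [Measure.real, mul_comm]
    rw [e, mul_assoc]
    exact mul_le_mul_of_nonneg_left (hM x hx.1.le hx.2) hs.le
  have hc : ∫ x in Set.Ioc a y, s * M = s * M * (y - a) := by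
    simp [Measure.real, Real.volume_Ioc, ENNReal.toReal_ofReal (sub_nonneg.2 hay), mul_comm]
  rw [hl] at hsw
  rw [hc, ← hsw] at hr
  linarith

lemma aux_exp (t : ℝ) (ht : t ≤ 1) : Real.exp t ≤ 1 + t + t ^ 2 := by
  rcases le_or_gt (-1) t with h | h
  · have := Real.abs_exp_sub_one_sub_id_le (abs_le.2 ⟨h, ht⟩)
    have := (abs_le.1 this).2
    linarith
  · have : Real.exp t ≤ 1 := Real.exp_le_one_iff.2 (by linarith)
    nlinarith

lemma aux_low {Ω : Type*} [MeasurableSpace Ω] (P : Measure Ω) [IsProbabilityMeasure P]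
    (X : Ω → ℝ) (hX : Measurable X) (hint : Integrable X P)
    (hmom2 : Integrable (fun ω => (X ω) ^ 2) P) (s : ℝ) (hs : 0 < s) :
    ∫ ω, Real.exp (s * min (X ω) (1 / s)) ∂P
      ≤ 1 + s * ∫ ω, X ω ∂P + s ^ 2 * ∫ ω, (X ω) ^ 2 ∂P := by
  have hi : Integrable (fun ω => Real.exp (s * min (X ω) (1/s))) P := by
    refine Integrable.of_bound (by fun_prop) (Real.exp (s * (1/s))) ?_
    filter_upwards with ω
    rw [Real.norm_eq_abs, Real.abs_exp]
    exact Real.exp_le_exp.2 (mul_le_mul_of_nonneg_left (min_le_right _ _) hs.le)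
  have h1 : Integrable (fun ω => 1 + s * X ω) P := (integrable_const _).add (hint.const_mul s)
  have e : ∫ ω, (1 + s * X ω + s ^ 2 * (X ω) ^ 2) ∂P
      = 1 + s * ∫ ω, X ω ∂P + s ^ 2 * ∫ ω, (X ω) ^ 2 ∂P := by
    rw [integral_add h1 (hmom2.const_mul _), integral_add (integrable_const _) (hint.const_mul s),
      integral_const_mul, integral_const_mul]
    simp
  rw [← e]
  refine integral_mono hi (h1.add (hmom2.const_mul _)) ?_
  intro ω
  have hs1 : s * (1 / s) = 1 := by field_simp
  have hle : s * min (X ω) (1/s) ≤ 1 := by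
    exact (mul_le_mul_of_nonneg_left (min_le_right _ _) hs.le).trans hs1.le
  have h2 := aux_exp _ hle
  have h3 : s * min (X ω) (1/s) ≤ s * X ω := mul_le_mul_of_nonneg_left (min_le_left _ _) hs.le
  have h4 : (s * min (X ω) (1/s)) ^ 2 ≤ s ^ 2 * (X ω) ^ 2 := by
    rw [mul_pow]
    refine mul_le_mul_of_nonneg_left ?_ (by positivity)
    have : 0 < 1 / s := by positivity
    rcases le_total (X ω) (1/s) with h | h
    · rw [min_eq_left h]
    · rw [min_eq_right h]; gcongr
  show _ ≤ 1 + s * X ω + s ^ 2 * (X ω) ^ 2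
  linarith

lemma aux_lim (κ c C : ℝ) (hκ : 0 < κ) (hc : 0 < c) :
    Filter.Tendsto (fun y : ℝ => (c * Real.log y) ^ (1 + κ) - C * (c * Real.log y))
      Filter.atTop Filter.atTop := by
  have hL : Filter.Tendsto (fun y : ℝ => c * Real.log y) Filter.atTop Filter.atTop :=
    Real.tendsto_log_atTop.const_mul_atTop hc
  have h : Filter.Tendsto (fun t : ℝ => t * (t ^ κ - C)) Filter.atTop Filter.atTop :=
    Filter.tendsto_id.atTop_mul_atTop₀
      (Filter.tendsto_atTop_add_const_right _ (-C) (tendsto_rpow_atTop hκ))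
  refine (h.comp hL).congr' ?_
  filter_upwards [hL.eventually_gt_atTop 0] with y hy
  simp only [Function.comp]
  rw [Real.rpow_add hy, Real.rpow_one]
  ring

/-- Explicit threshold for Theorem 2: for every `η ∈ (0,1)` there is `y*_η` such that
for `y > y*_η` and `s(y) = (q(y) - log y + log(η|μ|))/y` one has
`E[exp(s(y) min(X₁,y))] ≤ 1`, hence the adjustment coefficient satisfies
`γ(y) ≥ s(y)`. -/
theorem adjustment_coefficient_lower_bound_lighter_tails
    {Ω : Type*} [MeasurableSpace Ω] (P : Measure Ω) [IsProbabilityMeasure P]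
    (X : Ω → ℝ) (hX : Measurable X)
    (hint : Integrable X P)
    (hmean : ∫ ω, X ω ∂P < 0)
    (hmom2 : Integrable (fun ω => (X ω) ^ 2) P)
    (q : ℝ → ℝ)
    (hq : ∀ x : ℝ, q x = -Real.log ((P {ω | x < X ω}).toReal))
    (hconc : ConcaveOn ℝ (Set.Ioi 0) q)
    (κ : ℝ) (hκ : κ ∈ Set.Ioo (0:ℝ) 1) (yκ : ℝ) (hyκ : 0 < yκ)
    (hqbound : ∀ y : ℝ, yκ ≤ y →
      Real.log y ^ (1 + κ) ≤ q y ∧ q y ≤ y ^ (1 - κ)) :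
    ∀ η : ℝ, η ∈ Set.Ioo (0:ℝ) 1 →
      ∃ yη : ℝ, ∀ y : ℝ, yη < y →
        (∫ ω, Real.exp ((q y - Real.log y + Real.log (η * |∫ ω', X ω' ∂P|)) / y
            * min (X ω) y) ∂P ≤ 1) ∧
        (q y - Real.log y + Real.log (η * |∫ ω', X ω' ∂P|)) / y
          ≤ sSup {s : ℝ | 0 ≤ s ∧ ∫ ω, Real.exp (s * min (X ω) y) ∂P ≤ 1} := by
  intro η hη
  obtain ⟨hκ0, hκ1⟩ := hκ
  obtain ⟨hη0, hη1⟩ := hη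
  set μ := ∫ ω, X ω ∂P with hμ
  set V := ∫ ω, (X ω) ^ 2 ∂P with hV
  have hV0 : 0 ≤ V := integral_nonneg (fun ω => sq_nonneg _)
  set m := |μ| with hm
  have hmμ : μ = -m := by rw [hm, abs_of_neg hmean]; ring
  have hm0 : 0 < m := by linarith
  have hd : 0 < (1 - η) * m / 2 := by
    have : 0 < 1 - η := by linarith
    positivity
  have hηm : 0 < η * m := by positivity
  -- tail positivity
  have htail : ∀ y, yκ ≤ y → 1 < y → 0 < (P {ω | y < X ω}).toReal := by
    intro y h1 h2
    have h3 := (hqbound y h1).1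
    have h4 : 0 < Real.log y ^ (1 + κ) := Real.rpow_pos_of_pos (Real.log_pos h2) _
    refine lt_of_le_of_ne ENNReal.toReal_nonneg (fun h => ?_)
    rw [hq, ← h] at h3
    simp at h3
    linarith
  have htq : ∀ y, yκ ≤ y → 1 < y → (P {ω | y < X ω}).toReal = Real.exp (-q y) := by
    intro y h1 h2
    rw [hq, neg_neg, Real.exp_log (htail y h1 h2)]
  have hrp : Filter.Tendsto (fun y : ℝ => y ^ κ) Filter.atTop Filter.atTop :=
    tendsto_rpow_atTop hκ0
  have E1 := (aux_lim κ 1 1 hκ0 one_pos).eventually_ge_atTop (1 - Real.log (η * m))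
  have E2 := Real.tendsto_log_atTop.eventually_ge_atTop (Real.log (η * m))
  have E3 := hrp.eventually_ge_atTop (V / ((1 - η) * m / 2))
  have E4 := (aux_lim κ κ (1 / κ) hκ0 hκ0).eventually_ge_atTop (1 - Real.log ((1 - η) * m / 2))
  have E5 := hrp.eventually_gt_atTop (max yκ 1)
  have E6 := Filter.eventually_gt_atTop (max yκ 1)
  obtain ⟨Y, hY⟩ := Filter.eventually_atTop.1
    (E1.and (E2.and (E3.and (E4.and (E5.and E6)))))
  refine ⟨Y, fun y hy => ?_⟩
  obtain ⟨e1, e2, e3, e4, e5, e6⟩ := hY y hy.le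
  have hyk : yκ < y := (le_max_left _ _).trans_lt e6
  have hy1 : 1 < y := (le_max_right _ _).trans_lt e6
  have hy0 : 0 < y := by linarith
  have hpk : yκ < y ^ κ := (le_max_left _ _).trans_lt e5
  have hp1 : 1 < y ^ κ := (le_max_right _ _).trans_lt e5
  have hp0 : 0 < y ^ κ := by linarith
  obtain ⟨hqa, hqb⟩ := hqbound y hyk.le
  set s := (q y - Real.log y + Real.log (η * m)) / y with hs
  have hsy : s * y = q y - Real.log y + Real.log (η * m) := by
    rw [hs]; field_simp
  have hsy1 : 1 ≤ s * y := by
    rw [hsy]; simp only [one_mul] at e1; linarith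
  have hs0 : 0 < s := by
    by_contra h
    nlinarith
  have hsk : s * y ^ κ ≤ 1 := by
    have h1 : s * y ≤ y ^ (1 - κ) := by rw [hsy]; linarith
    have h2 : y ^ (1 - κ) * y ^ κ = y := by
      rw [← Real.rpow_add hy0]; simp
    have h3 : s * y * y ^ κ ≤ y := by
      rw [← h2] ; rw [h2]
      calc s * y * y ^ κ ≤ y ^ (1 - κ) * y ^ κ := mul_le_mul_of_nonneg_right h1 hp0.le
        _ = y := h2
    nlinarith
  set a := 1 / s with ha
  have hsa : s * a = 1 := by rw [ha]; field_simp
  have hay : a ≤ y := by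
    rw [ha, div_le_iff₀ hs0]; linarith
  have hka : y ^ κ ≤ a := by
    rw [ha, le_div_iff₀ hs0]; linarith
  have ha0 : 0 < a := by linarith
  have hqa' : (κ * Real.log y) ^ (1 + κ) ≤ q a := by
    refine le_trans ?_ (hqbound a (by linarith)).1
    have hl := Real.log_pos hy1
    refine Real.rpow_le_rpow (by positivity) ?_ (by linarith)
    rw [← Real.log_rpow hy0]
    exact Real.log_le_log hp0 hka
  have hB : y * Real.exp (1 - q a) ≤ (1 - η) * m / 2 := by
    have h1 : 1 / κ * (κ * Real.log y) = Real.log y := by field_simp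
    rw [h1] at e4
    calc y * Real.exp (1 - q a) = Real.exp (Real.log y + (1 - q a)) := by
          rw [Real.exp_add, Real.exp_log hy0]
      _ ≤ Real.exp (Real.log ((1 - η) * m / 2)) := Real.exp_le_exp.2 (by linarith)
      _ = _ := Real.exp_log hd
  have hA : s * V ≤ (1 - η) * m / 2 := by
    rw [div_le_iff₀ hd] at e3
    calc s * V ≤ s * (y ^ κ * ((1 - η) * m / 2)) := mul_le_mul_of_nonneg_left e3 hs0.le
      _ = (s * y ^ κ) * ((1 - η) * m / 2) := by ring
      _ ≤ 1 * ((1 - η) * m / 2) := mul_le_mul_of_nonneg_right hsk hd.le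
      _ = _ := one_mul _
  have hend : Real.exp (s * y - q y) = η * m / y := by
    have : s * y - q y = Real.log (η * m) - Real.log y := by rw [hsy]; ring
    rw [this, Real.exp_sub, Real.exp_log hηm, Real.exp_log hy0]
  have hM : ∀ x, a ≤ x → x ≤ y → Real.exp (s * x) * (P {ω | x < X ω}).toReal
      ≤ η * m / y + Real.exp (1 - q a) := by
    intro x h1 h2
    rw [htq x (by linarith) (by linarith), ← Real.exp_add]
    have hg : ConcaveOn ℝ (Set.Ioi 0) (fun x => q x + (-s) * x) := by
      refine hconc.add ⟨convex_Ioi 0, ?_⟩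
      intro u _ v _ b c _ _ _
      simp only [smul_eq_mul]
      apply le_of_eq; ring
    have h3 := hg.min_le_of_mem_Icc (x := a) (y := y) (z := x) ha0 hy0 ⟨h1, h2⟩
    have p1 := Real.exp_pos (s * y - q y)
    have p2 := Real.exp_pos (1 - q a)
    rw [← hend]
    rcases min_le_iff.1 h3 with h | h
    · have : Real.exp (s * x + -q x) ≤ Real.exp (1 - q a) := Real.exp_le_exp.2 (by linarith)
      linarith
    · have : Real.exp (s * x + -q x) ≤ Real.exp (s * y - q y) := Real.exp_le_exp.2 (by linarith)
      linarith
  have hmain : ∫ ω, Real.exp (s * min (X ω) y) ∂P ≤ 1 := by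
    have h1 := aux_layer P X hX s a y _ hs0 hay hM
    have h2 := aux_low P X hX hint hmom2 s hs0
    rw [← hμ, ← hV, ← ha] at h2
    have h3 : s * (η * m / y + Real.exp (1 - q a)) * (y - a)
        ≤ s * (η * m + y * Real.exp (1 - q a)) := by
      have : s * (η * m + y * Real.exp (1 - q a))
          = s * (η * m / y + Real.exp (1 - q a)) * y := by field_simp
      rw [this]
      refine mul_le_mul_of_nonneg_left (by linarith) (by positivity)
    have h4 : s * (μ + s * V + η * m + y * Real.exp (1 - q a)) ≤ 0 :=
      mul_nonpos_of_nonneg_of_nonpos hs0.le (by rw [hmμ]; linarith)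
    nlinarith
  refine ⟨hmain, le_csSup ⟨q y / y, ?_⟩ ⟨hs0.le, hmain⟩⟩
  rintro r ⟨hr0, hr⟩
  have hi : Integrable (fun ω => Real.exp (r * min (X ω) y)) P := by
    refine Integrable.of_bound (by fun_prop) (Real.exp (r * y)) ?_
    filter_upwards with ω
    rw [Real.norm_eq_abs, Real.abs_exp]
    exact Real.exp_le_exp.2 (mul_le_mul_of_nonneg_left (min_le_right _ _) hr0)
  have hms : MeasurableSet {ω | y < X ω} := measurableSet_lt measurable_const hX
  have h1 : ∫ ω, Set.indicator {ω | y < X ω} (fun _ => Real.exp (r * y)) ω ∂P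
      ≤ ∫ ω, Real.exp (r * min (X ω) y) ∂P := by
    refine integral_mono ((integrable_const _).indicator hms) hi ?_
    intro ω
    refine Set.indicator_apply_le' (fun h => ?_) (fun _ => (Real.exp_pos _).le)
    have h' : y < X ω := h
    show _ ≤ Real.exp (r * min (X ω) y)
    rw [min_eq_right h'.le]
  rw [integral_indicator_const _ hms, smul_eq_mul, Measure.real, htq y hyk.le hy1,
    ← Real.exp_add] at h1
  have h2 := Real.exp_le_one_iff.1 (h1.trans hr)
  rw [le_div_iff₀ hy0]
  linarith
end

section
/- For every s > 0: ∫_0^{1/s} s·e^{sx}·P(X > x) dx ≤ s·E[max{X,0}] + (e/2)·s²·E[(max{X,0})²]. -/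
open MeasureTheory Real

/-- Bound (3.21): for `s > 0`,
`∫_0^{1/s} s e^{sx} P(X > x) dx ≤ s E[max(X,0)] + (e/2) s² E[(max(X,0))²]`. -/
theorem tail_integral_bound
    {Ω : Type*} [MeasurableSpace Ω] (P : Measure Ω) [IsProbabilityMeasure P]
    (X : Ω → ℝ) (hX : Measurable X)
    (hmom1 : Integrable (fun ω => max (X ω) 0) P)
    (hmom2 : Integrable (fun ω => max (X ω) 0 ^ 2) P)
    (s : ℝ) (hs : 0 < s) :
    ∫ x in (0:ℝ)..(1 / s), s * Real.exp (s * x) * (P {ω | x < X ω}).toReal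
      ≤ s * (∫ ω, max (X ω) 0 ∂P)
        + Real.exp 1 / 2 * s ^ 2 * ∫ ω, max (X ω) 0 ^ 2 ∂P := by
  have hkey : ∀ u : ℝ, 0 ≤ u → u ≤ 1 → Real.exp u ≤ 1 + Real.exp 1 * u := by
    intro u h0 h1
    have h2 : 1 - u ≤ Real.exp (-u) := by linarith [Real.add_one_le_exp (-u)]
    have h3 : Real.exp u * Real.exp (-u) = 1 := by rw [← Real.exp_add]; simp
    have h4 : Real.exp u ≤ Real.exp 1 := Real.exp_le_exp.mpr h1
    have h5 := mul_le_mul_of_nonneg_left h2 (Real.exp_pos u).le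
    have h6 := mul_le_mul_of_nonneg_right h4 h0
    nlinarith
  have hanti : Antitone (fun x : ℝ => (P {ω | x < X ω}).toReal) := by
    intro a b hab
    exact ENNReal.toReal_mono (measure_ne_top _ _)
      (measure_mono (fun ω (h : b < X ω) => lt_of_le_of_lt hab h))
  have hmeas : Measurable
      (fun x : ℝ => s * Real.exp (s * x) * (P {ω | x < X ω}).toReal) :=
    (by fun_prop : Measurable (fun x : ℝ => s * Real.exp (s * x))).mul hanti.measurable
  have hs1 : (0:ℝ) ≤ 1 / s := by positivity
  have hint : ∀ y : ℝ, ∫ t in (0:ℝ)..y, (s + Real.exp 1 * s ^ 2 * t)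
      = s * y + Real.exp 1 / 2 * s ^ 2 * y ^ 2 := by
    intro y
    rw [intervalIntegral.integral_add (by simp)
      (Continuous.intervalIntegrable (by fun_prop) _ _),
      intervalIntegral.integral_const_mul, integral_id]
    simp
    ring
  have hlc := lintegral_comp_eq_lintegral_meas_lt_mul P (f := fun ω => max (X ω) 0)
    (g := fun t => s + Real.exp 1 * s ^ 2 * t)
    (Filter.Eventually.of_forall fun ω => le_max_right _ _)
    (hX.max measurable_const).aemeasurable
    (fun t _ => Continuous.intervalIntegrable (by fun_prop) _ _)
    ((ae_restrict_iff' measurableSet_Ioi).mpr (Filter.Eventually.of_forall fun t ht => by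
      have : (0:ℝ) < t := ht
      positivity))
  simp only [hint] at hlc
  have hI : Integrable (fun ω => s * max (X ω) 0
      + Real.exp 1 / 2 * s ^ 2 * max (X ω) 0 ^ 2) P :=
    (hmom1.const_mul s).add (hmom2.const_mul _)
  have hnn : ∀ ω, 0 ≤ s * max (X ω) 0 + Real.exp 1 / 2 * s ^ 2 * max (X ω) 0 ^ 2 := by
    intro ω
    have : 0 ≤ max (X ω) 0 := le_max_right _ _
    positivity
  rw [← integral_const_mul, ← integral_const_mul,
    ← integral_add (hmom1.const_mul s) (hmom2.const_mul _),
    intervalIntegral.integral_of_le hs1,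
    integral_eq_lintegral_of_nonneg_ae
      (Filter.Eventually.of_forall fun x => by positivity) hmeas.aestronglyMeasurable]
  refine ENNReal.toReal_le_of_le_ofReal (integral_nonneg hnn) ?_
  rw [ofReal_integral_eq_lintegral_ofReal hI (Filter.Eventually.of_forall hnn), hlc]
  refine le_trans ?_ (lintegral_mono_set (Set.Ioc_subset_Ioi_self (a := 1 / s)))
  refine setLIntegral_mono' measurableSet_Ioc ?_
  intro x hx
  have hx0 : 0 < x := hx.1
  have hx1 : s * x ≤ 1 := by
    have := mul_le_mul_of_nonneg_left hx.2 hs.le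
    rwa [mul_one_div_cancel hs.ne'] at this
  have hset : {ω | x < max (X ω) 0} = {ω | x < X ω} := by
    ext ω
    simp [lt_max_iff, hx0.not_gt]
  rw [hset, mul_comm (s * _), ENNReal.ofReal_mul ENNReal.toReal_nonneg,
    ENNReal.ofReal_toReal (measure_ne_top _ _)]
  gcongr
  have := mul_le_mul_of_nonneg_left (hkey (s * x) (by positivity) hx1) hs.le
  linarith
end

section
/- Let q : (0,∞) → ℝ be concave. Then for every s > 0 and every y > 1/s: ∫_{1/s}^{y} s·e^{sx − q(x)} dx ≤ s·y·max{ e^{1 − q(1/s)}, e^{sy − q(y)} }. -/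
open Real

/-- Bound (3.23): if `q` is concave on `(0,∞)`, then for `s > 0` and `y > 1/s`,
`∫_{1/s}^y s e^{sx - q(x)} dx ≤ s y max{e^{1 - q(1/s)}, e^{sy - q(y)}}`. -/
theorem concave_exponent_integral_bound
    (q : ℝ → ℝ) (hconc : ConcaveOn ℝ (Set.Ioi 0) q)
    (s y : ℝ) (hs : 0 < s) (hy : 1 / s < y) :
    ∫ x in (1 / s)..y, s * Real.exp (s * x - q x)
      ≤ s * y * max (Real.exp (1 - q (1 / s))) (Real.exp (s * y - q y)) := by
  have h0 : 0 < 1 / s := by positivity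
  have hy0 : 0 < y := h0.trans hy
  have hlin : ConvexOn ℝ (Set.Ioi (0:ℝ)) (fun x => s * x) := by
    refine ⟨convex_Ioi 0, ?_⟩
    intro a _ b _ u v _ _ _
    simp only [smul_eq_mul]
    apply le_of_eq
    ring
  have hconv : ConvexOn ℝ (Set.Ioi (0:ℝ)) (fun x => s * x - q x) := hlin.sub hconc
  set M := max (Real.exp (1 - q (1 / s))) (Real.exp (s * y - q y)) with hM
  have hM0 : 0 < M := lt_max_of_lt_left (Real.exp_pos _)
  have hb : ∀ x ∈ Set.uIoc (1 / s) y, ‖s * Real.exp (s * x - q x)‖ ≤ s * M := by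
    intro x hx
    rw [Set.uIoc_of_le hy.le] at hx
    rw [Real.norm_of_nonneg (by positivity)]
    refine mul_le_mul_of_nonneg_left ?_ hs.le
    have h := hconv.le_max_of_mem_Icc (Set.mem_Ioi.2 h0) (Set.mem_Ioi.2 hy0) ⟨hx.1.le, hx.2⟩
    have hs1 : s * (1 / s) = 1 := by field_simp
    simp only [hs1] at h
    rcases le_max_iff.1 h with h | h
    · exact le_max_of_le_left (Real.exp_le_exp.2 h)
    · exact le_max_of_le_right (Real.exp_le_exp.2 h)
  have h := intervalIntegral.norm_integral_le_of_norm_le_const hb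
  rw [abs_of_pos (sub_pos.2 hy)] at h
  refine (Real.le_norm_self _).trans (h.trans ?_)
  have : 0 < s * M * (1 / s) := by positivity
  nlinarith
end

section
/- For every s > 0 and every y > 1/s: E[ e^{s·min{X_1, y}} ] ≤ 1 + s·( μ + s·(e/2)·μ_2 + y·max{ e^{1 − q(1/s)}, e^{sy − q(y)} } ). -/
open MeasureTheory Real


lemma exp_le_quad (u : ℝ) (hu : u ≤ 1) : exp u ≤ 1 + u + exp 1 / 2 * u ^ 2 := by
  have hd : ∀ x : ℝ, HasDerivAt (fun u : ℝ => 1 + u + exp 1 / 2 * u ^ 2 - exp u)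
      (1 + exp 1 * x - exp x) x := by
    intro x
    have h := (((hasDerivAt_id x).const_add 1).add
      (((hasDerivAt_id x).pow 2).const_mul (exp 1 / 2))).sub (Real.hasDerivAt_exp x)
    refine HasDerivAt.congr_deriv (f := fun u : ℝ => 1 + u + exp 1 / 2 * u ^ 2 - exp u) h ?_
    simp
    ring
  have hc : Continuous (fun u : ℝ => 1 + u + exp 1 / 2 * u ^ 2 - exp u) := by fun_prop
  have he : 1 ≤ exp 1 := by have := Real.add_one_le_exp 1; linarith
  rcases le_total u 0 with h | h
  · have := antitoneOn_of_deriv_nonpos (convex_Iic (0:ℝ)) hc.continuousOn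
      (fun x _ => (hd x).differentiableAt.differentiableWithinAt) (by
        intro x hx
        rw [interior_Iic] at hx
        rw [(hd x).deriv]
        have h1 := Real.add_one_le_exp x
        have h2 : x < 0 := hx
        nlinarith)
    have := this (Set.mem_Iic.2 h) (Set.mem_Iic.2 le_rfl) h
    simp at this
    linarith
  · have := monotoneOn_of_deriv_nonneg (convex_Icc (0:ℝ) 1) hc.continuousOn
      (fun x _ => (hd x).differentiableAt.differentiableWithinAt) (by
        intro x hx
        rw [interior_Icc] at hx
        rw [(hd x).deriv]
        have h1 := convexOn_exp.2 (Set.mem_univ (0:ℝ)) (Set.mem_univ (1:ℝ))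
          (sub_nonneg.2 hx.2.le) hx.1.le (by ring)
        simp at h1
        have h2 := hx.1
        nlinarith)
    have := this (Set.mem_Icc.2 ⟨le_rfl, zero_le_one⟩) (Set.mem_Icc.2 ⟨h, hu⟩) h
    simp at this
    linarith

lemma layer_lb (s a y x : ℝ) (hs : 0 < s) (hay : a < y) (hax : a < x) :
    exp (s * min x y) - exp (s * a) ≤
      ∫ t in Set.Ioc a y, (if t < x then s * exp (s * t) else 0) := by
  have ham : a ≤ min x y := le_min hax.le hay.le
  have h1 : ∫ t in a..(min x y), s * exp (s * t) = exp (s * min x y) - exp (s * a) := by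
    apply intervalIntegral.integral_eq_sub_of_hasDerivAt (f := fun t => exp (s * t))
    · intro t _
      have := ((hasDerivAt_id t).const_mul s).exp
      refine HasDerivAt.congr_deriv (f := fun t => exp (s * t)) this ?_
      simp
      ring
    · exact Continuous.intervalIntegrable (by fun_prop) _ _
  have hint : IntegrableOn (fun t => s * exp (s * t)) (Set.Ioc a y) :=
    ((by fun_prop : Continuous fun t => s * exp (s * t)).integrableOn_Icc).mono_set
      Set.Ioc_subset_Icc_self
  have hind : (fun t => if t < x then s * exp (s * t) else 0)
      = (Set.Iio x).indicator (fun t => s * exp (s * t)) := by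
    ext t; simp [Set.indicator]
  rw [← h1, intervalIntegral.integral_of_le ham, integral_Ioc_eq_integral_Ioo, hind,
    setIntegral_indicator measurableSet_Iio]
  apply setIntegral_mono_set (hint.mono_set Set.inter_subset_left)
  · exact Filter.Eventually.of_forall fun t => by positivity
  · apply Filter.Eventually.of_forall
    intro t ht
    exact ⟨⟨ht.1, (ht.2.trans_le (min_le_right _ _)).le⟩, ht.2.trans_le (min_le_left _ _)⟩

/-- Bound (3.24): with `q(x) = -log P(X₁ > x)` concave on `(0,∞)`, for `s > 0`
and `y > 1/s`,
`E[e^{s min(X₁,y)}] ≤ 1 + s (μ + s (e/2) μ₂ + y max{e^{1-q(1/s)}, e^{sy-q(y)}})`. -/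
theorem truncated_mgf_bound_concave_hazard
    {Ω : Type*} [MeasurableSpace Ω] (P : Measure Ω) [IsProbabilityMeasure P]
    (X : Ω → ℝ) (hX : Measurable X)
    (hint : Integrable X P)
    (hmom2 : Integrable (fun ω => (X ω) ^ 2) P)
    (q : ℝ → ℝ)
    (hq : ∀ x : ℝ, q x = -Real.log ((P {ω | x < X ω}).toReal))
    (hconc : ConcaveOn ℝ (Set.Ioi 0) q)
    (s y : ℝ) (hs : 0 < s) (hy : 1 / s < y) :
    ∫ ω, Real.exp (s * min (X ω) y) ∂P
      ≤ 1 + s * ((∫ ω, X ω ∂P) + s * (Real.exp 1 / 2) * (∫ ω, (X ω) ^ 2 ∂P)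
          + y * max (Real.exp (1 - q (1 / s))) (Real.exp (s * y - q y))) := by
  set a := 1 / s with ha
  set M := max (Real.exp (1 - q a)) (Real.exp (s * y - q y)) with hM
  have ha0 : 0 < a := by positivity
  have hsa : s * a = 1 := by rw [ha]; field_simp
  have hy0 : 0 < y := ha0.trans hy
  have hms : ∀ t, MeasurableSet {ω | t < X ω} := fun t => measurableSet_lt measurable_const hX
  have hp : ∀ t, P.real {ω | t < X ω} ≤ exp (-q t) := by
    intro t
    rw [hq t, neg_neg]
    change _ ≤ exp (log (P.real {ω | t < X ω}))
    rcases eq_or_lt_of_le (measureReal_nonneg (μ := P) (s := {ω | t < X ω})) with h | h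
    · rw [← h]; positivity
    · rw [Real.exp_log h]
  have hMt : ∀ t ∈ Set.Icc a y, exp (s * t) * P.real {ω | t < X ω} ≤ M := by
    intro t ht
    have hcv : ConvexOn ℝ (Set.Ioi 0) (fun t => s * t - q t) := by
      refine ConvexOn.sub ⟨convex_Ioi 0, ?_⟩ hconc
      intro x _ y _ c d _ _ _
      simp only [smul_eq_mul]
      apply le_of_eq
      ring
    have h1 := hcv.le_max_of_mem_Icc (x := a) (y := y) ha0 hy0 ht
    calc exp (s * t) * P.real {ω | t < X ω} ≤ exp (s * t) * exp (-q t) := by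
          gcongr; exact hp t
      _ = exp (s * t - q t) := by rw [← Real.exp_add]; ring_nf
      _ ≤ exp (max (s * a - q a) (s * y - q y)) := Real.exp_le_exp.2 h1
      _ = M := by rw [hsa, Real.exp_monotone.map_max]
  let F : Ω → ℝ → ℝ := fun ω t => if t < X ω then s * exp (s * t) else 0
  have hFm : Measurable (Function.uncurry F) := by
    apply Measurable.ite
    · exact measurableSet_lt measurable_snd (hX.comp measurable_fst)
    · fun_prop
    · exact measurable_const
  have hbd : ∀ ω, ∀ t ∈ Set.Ioc a y, ‖F ω t‖ ≤ s * exp (s * y) := by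
    intro ω t ht
    simp only [F]
    split_ifs
    · rw [Real.norm_of_nonneg (by positivity)]
      have := ht.2
      gcongr
    · simp; positivity
  have hFi : Integrable (Function.uncurry F) (P.prod (volume.restrict (Set.Ioc a y))) := by
    refine Integrable.of_bound hFm.aestronglyMeasurable (s * exp (s * y)) ?_
    have : ∀ᵐ z ∂(P.prod (volume.restrict (Set.Ioc a y))), z.2 ∈ Set.Ioc a y :=
      Measure.quasiMeasurePreserving_snd.ae (ae_restrict_mem measurableSet_Ioc)
    filter_upwards [this] with z hz
    exact hbd z.1 z.2 hz
  have hC : Integrable (fun ω => ∫ t in Set.Ioc a y, F ω t) P := hFi.integral_prod_left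
  have hA : Integrable (fun ω => 1 + s * X ω + exp 1 / 2 * s ^ 2 * (X ω) ^ 2) P :=
    ((integrable_const 1).add (hint.const_mul s)).add (hmom2.const_mul _)
  have hB : Integrable ({ω | a < X ω}.indicator (fun _ => exp 1)) P :=
    (integrable_const _).indicator (hms a)
  have hpt : ∀ ω, exp (s * min (X ω) y) ≤ (1 + s * X ω + exp 1 / 2 * s ^ 2 * (X ω) ^ 2)
      + {ω | a < X ω}.indicator (fun _ => exp 1) ω + ∫ t in Set.Ioc a y, F ω t := by
    intro ω
    rcases le_or_gt (X ω) a with h | h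
    · have h1 : s * X ω ≤ 1 := by rw [← hsa]; gcongr
      have h2 := exp_le_quad _ h1
      have h3 : 0 ≤ ∫ t in Set.Ioc a y, F ω t := by
        apply integral_nonneg
        intro t
        simp only [F]
        split_ifs
        · positivity
        · simp
      rw [min_eq_left (h.trans hy.le), Set.indicator_of_notMem (by simpa using h)]
      nlinarith
    · have h1 := layer_lb s a y (X ω) hs hy h
      rw [Set.indicator_of_mem (by simpa using h)]
      rw [hsa] at h1
      have h2 : 0 ≤ 1 + s * X ω + exp 1 / 2 * s ^ 2 * (X ω) ^ 2 := by
        have := ha0.trans h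
        positivity
      simp only [F]
      linarith
  have hCle : ∫ ω, (∫ t in Set.Ioc a y, F ω t) ∂P ≤ (s * y - 1) * M := by
    rw [integral_integral_swap hFi]
    have hinner : ∀ t, ∫ ω, F ω t ∂P = s * (exp (s * t) * P.real {ω | t < X ω}) := by
      intro t
      have : (fun ω => F ω t) = {ω | t < X ω}.indicator (fun _ => s * exp (s * t)) := by
        ext ω; simp [F, Set.indicator]
      rw [this, integral_indicator_const _ (hms t), smul_eq_mul]
      ring
    calc ∫ t in Set.Ioc a y, ∫ ω, F ω t ∂P ≤ ∫ t in Set.Ioc a y, s * M := by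
          apply setIntegral_mono_on hFi.integral_prod_right
            (integrable_const _) measurableSet_Ioc
          intro t ht
          simp only [Function.uncurry_apply_pair]
          rw [hinner]
          have := hMt t ⟨ht.1.le, ht.2⟩
          gcongr
      _ = (s * y - 1) * M := by
          rw [setIntegral_const, Real.volume_real_Ioc_of_le hy.le, smul_eq_mul, ← hsa]
          ring
  have hBle : ∫ ω, {ω | a < X ω}.indicator (fun _ => exp 1) ω ∂P ≤ M := by
    rw [integral_indicator_const _ (hms a), smul_eq_mul]
    have := hMt a ⟨le_rfl, hy.le⟩
    rw [hsa] at this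
    linarith
  have hAeq : ∫ ω, (1 + s * X ω + exp 1 / 2 * s ^ 2 * (X ω) ^ 2) ∂P
      = 1 + s * (∫ ω, X ω ∂P) + exp 1 / 2 * s ^ 2 * (∫ ω, (X ω) ^ 2 ∂P) := by
    have hA1 : Integrable (fun ω => 1 + s * X ω) P :=
      (integrable_const 1).add (hint.const_mul s)
    rw [integral_add hA1 (hmom2.const_mul _),
      integral_add (integrable_const 1) (hint.const_mul s), integral_const_mul,
      integral_const_mul]
    simp
  have hmain := integral_mono_of_nonneg (μ := P)
    (Filter.Eventually.of_forall fun ω => (Real.exp_pos (s * min (X ω) y)).le)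
    ((hA.add hB).add hC) (Filter.Eventually.of_forall hpt)
  have hsum := integral_add (hA.add hB) hC
  have hsum2 := integral_add hA hB
  simp only [Pi.add_apply] at hmain hsum hsum2
  rw [hsum, hsum2, hAeq] at hmain
  nlinarith
end

section
/- For every δ ∈ [1,2] and every u > 0: (e^{−u} − 1 + u) / u^δ ≤ 1/δ; equivalently, MG_δ := sup_{u>0} (e^{−u}−1+u)/u^δ ≤ 1/δ. -/
open Real

/-- (a12), second bound: for `δ ∈ [1,2]` and `u > 0`,
`(e^{-u} - 1 + u)/u^δ ≤ 1/δ`; equivalently `MG δ ≤ 1/δ`. -/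
theorem MG_le (δ : ℝ) (hδ : δ ∈ Set.Icc (1:ℝ) 2) :
    (∀ u : ℝ, 0 < u →
      (Real.exp (-u) - 1 + u) / u ^ δ ≤ 1 / δ) ∧
    MG δ ≤ 1 / δ := by
  obtain ⟨h1, h2⟩ := hδ
  have hδ0 : 0 < δ := by linarith
  have key : ∀ u : ℝ, 0 < u → (Real.exp (-u) - 1 + u) / u ^ δ ≤ 1 / δ := by
    intro u hu
    have hder : ∀ x : ℝ, HasDerivAt
        (fun x : ℝ => x ^ δ / δ - (Real.exp (-x) - 1 + x))
        (x ^ (δ - 1) - (1 - Real.exp (-x))) x := by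
      intro x
      have ha := (Real.hasDerivAt_rpow_const (x := x) (p := δ) (Or.inr h1)).div_const δ
      have hb := (((hasDerivAt_id x).neg.exp).sub_const 1).add (hasDerivAt_id x)
      refine (ha.sub hb).congr_deriv ?_
      simp only [id, Pi.neg_apply]
      field_simp
      ring
    have hmono : MonotoneOn (fun x : ℝ => x ^ δ / δ - (Real.exp (-x) - 1 + x))
        (Set.Ici 0) := by
      refine monotoneOn_of_deriv_nonneg (convex_Ici 0)
        (fun x _ => (hder x).continuousAt.continuousWithinAt)
        (fun x _ => (hder x).differentiableAt.differentiableWithinAt) ?_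
      intro x hx
      rw [interior_Ici] at hx
      have hx0 : 0 < x := hx
      rw [(hder x).deriv]
      have e1 := Real.add_one_le_exp (-x)
      have e2 := Real.exp_pos (-x)
      rcases le_total x 1 with h | h
      · have := Real.rpow_le_rpow_of_exponent_ge hx0 h (show δ - 1 ≤ 1 by linarith)
        rw [Real.rpow_one] at this
        linarith
      · have := Real.one_le_rpow h (show 0 ≤ δ - 1 by linarith)
        linarith
    have h := hmono (Set.mem_Ici.2 le_rfl) (Set.mem_Ici.2 hu.le) hu.le
    simp only [Real.zero_rpow hδ0.ne', neg_zero, Real.exp_zero] at h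
    have hp := Real.rpow_pos_of_pos hu δ
    rw [div_le_iff₀ hp, one_div_mul_eq_div]
    norm_num at h
    linarith
  refine ⟨key, ?_⟩
  haveI : Nonempty (Set.Ioi (0:ℝ)) := ⟨⟨1, Set.mem_Ioi.2 one_pos⟩⟩
  exact ciSup_le fun u => key u u.2
end

section
/- For every δ ∈ [0,2]: (2−δ)^{2−δ} / (4−δ) ≤ 1/(1 + δ/2), i.e. (1 + δ/2)·(2−δ)^{2−δ} ≤ 4−δ (with the convention 0^0 = 1 at δ = 2). Equivalently, f_E(δ) := log(1 + δ/2) + (2−δ)·log(2−δ) − log(4−δ) ≤ 0 for all δ ∈ [0,2]. -/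
open Real

theorem fE_aux (x : ℝ) (h0 : 0 ≤ x) (h2 : x ≤ 2) : (2 - x / 2) * x ^ x ≤ 2 + x := by
  rcases le_total x 1 with h1 | h1
  · have h := Real.rpow_le_one h0 h1 h0
    nlinarith
  · have hb := rpow_one_add_le_one_add_mul_self (s := x - 1) (p := x - 1)
      (by linarith) (by linarith) (by linarith)
    have hx : x ^ x = x * x ^ (x - 1) := by
      rw [Real.rpow_sub_one (by linarith)]
      field_simp
    have e : 1 + (x - 1) = x := by ring
    rw [e] at hb
    rw [hx]
    have h3 : (2 - x / 2) * (x * x ^ (x - 1)) ≤ (2 - x / 2) * (x * (1 + (x - 1) * (x - 1))) := by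
      apply mul_le_mul_of_nonneg_left _ (by linarith)
      exact mul_le_mul_of_nonneg_left hb h0
    refine h3.trans ?_
    obtain ⟨t, rfl⟩ : ∃ t, x = 1 + t := ⟨x - 1, by ring⟩
    have ht0 : 0 ≤ t := by linarith
    have ht1 : 0 ≤ 1 - t := by linarith
    have : 0 ≤ (1 - t) * (3 + 3 * t + t ^ 2 * (1 - t)) := by positivity
    nlinarith

/-- (a13): for `δ ∈ [0,2]`, `(1 + δ/2)(2-δ)^{2-δ} ≤ 4-δ` (real powers, `0^0 = 1`);
equivalently `f_E(δ) = log(1+δ/2) + (2-δ)log(2-δ) - log(4-δ) ≤ 0`. -/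
theorem fE_nonpos (δ : ℝ) (hδ : δ ∈ Set.Icc (0:ℝ) 2) :
    (1 + δ / 2) * (2 - δ) ^ (2 - δ) ≤ 4 - δ ∧
    Real.log (1 + δ / 2) + (2 - δ) * Real.log (2 - δ) - Real.log (4 - δ) ≤ 0 := by
  obtain ⟨h0, h2⟩ := hδ
  have key : (1 + δ / 2) * (2 - δ) ^ (2 - δ) ≤ 4 - δ := by
    have h := fE_aux (2 - δ) (by linarith) (by linarith)
    have e1 : 2 - (2 - δ) / 2 = 1 + δ / 2 := by ring
    have e2 : 2 + (2 - δ) = 4 - δ := by ring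
    rwa [e1, e2] at h
  refine ⟨key, ?_⟩
  rcases h2.eq_or_lt with rfl | h2
  · norm_num
  · have hp : 0 < 2 - δ := by linarith
    have hq : 0 < (2 - δ) ^ (2 - δ) := Real.rpow_pos_of_pos hp _
    have h := Real.log_le_log (by positivity) key
    rw [Real.log_mul (by positivity) hq.ne', Real.log_rpow hp] at h
    linarith
end

section
/- For every δ ∈ [1,2]: ((δ−1)/δ)^{δ−1}·(2−δ)^{2−δ} ≤ 1/δ (with the convention 0^0 = 1 at the endpoints). Equivalently, f_G(δ) := (2−δ)·log δ + (δ−1)·log(δ−1) + (2−δ)·log(2−δ) ≤ 0 for all δ ∈ [1,2]. -/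
open Real

/-- (a15): for `δ ∈ [1,2]`, `((δ-1)/δ)^{δ-1} (2-δ)^{2-δ} ≤ 1/δ` (real powers,
`0^0 = 1`); equivalently
`f_G(δ) = (2-δ)log δ + (δ-1)log(δ-1) + (2-δ)log(2-δ) ≤ 0`. -/
theorem fG_nonpos (δ : ℝ) (hδ : δ ∈ Set.Icc (1:ℝ) 2) :
    ((δ - 1) / δ) ^ (δ - 1) * (2 - δ) ^ (2 - δ) ≤ 1 / δ ∧
    (2 - δ) * Real.log δ + (δ - 1) * Real.log (δ - 1)
      + (2 - δ) * Real.log (2 - δ) ≤ 0 := by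
  obtain ⟨h1, h2⟩ := hδ
  have h0 : 0 < δ := by linarith
  have ha : 0 ≤ δ - 1 := by linarith
  have hb : 0 ≤ 2 - δ := by linarith
  have hc : δ * (2 - δ) ≤ 1 := by nlinarith [sq_nonneg (δ - 1)]
  constructor
  · have e1 : (δ - 1) ^ (δ - 1) ≤ 1 := rpow_le_one ha (by linarith) ha
    have e2 : (δ * (2 - δ)) ^ (2 - δ) ≤ 1 := rpow_le_one (by positivity) hc hb
    have e3 : δ = δ ^ (δ - 1) * δ ^ (2 - δ) := by
      rw [← rpow_add h0]; ring_nf; simp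
    rw [mul_rpow h0.le hb] at e2
    rw [div_rpow ha h0.le, le_div_iff₀ h0]
    have hp : 0 < δ ^ (δ - 1) := rpow_pos_of_pos h0 _
    have e4 : (δ - 1) ^ (δ - 1) / δ ^ (δ - 1) * (2 - δ) ^ (2 - δ) * δ
        = (δ - 1) ^ (δ - 1) * (δ ^ (2 - δ) * (2 - δ) ^ (2 - δ)) := by
      calc _ = (δ - 1) ^ (δ - 1) / δ ^ (δ - 1) * (2 - δ) ^ (2 - δ)
            * (δ ^ (δ - 1) * δ ^ (2 - δ)) := by rw [← e3]
        _ = _ := by field_simp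
    rw [e4]
    exact mul_le_one₀ e1 (by positivity) e2
  · have e1 : (δ - 1) * Real.log (δ - 1) ≤ 0 :=
      mul_nonpos_of_nonneg_of_nonpos ha (log_nonpos ha (by linarith))
    rcases hb.eq_or_lt with h | h
    · rw [← h]; linarith
    · have e2 : (2 - δ) * Real.log (δ * (2 - δ)) ≤ 0 :=
        mul_nonpos_of_nonneg_of_nonpos hb (log_nonpos (by positivity) hc)
      rw [log_mul h0.ne' h.ne'] at e2
      linarith
end
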